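/- Let f be a measurable base multi-label classifier on ℝ^d outputting exactly k' labels from {1,…,c}. Fix x ∈ ℝ^d, σ > 0, R > 0, and an integer k with 1 ≤ k ≤ c. For δ ∈ ℝ^d, let p*(δ)_i = Pr(i ∈ f_{k'}(x + δ + ε)) where ε ∼ N(0, σ²I); write p_i = p*(0)_i. Let L = {a₁,…,a_d} ⊆ {1,…,c} and suppose reals p̲_{a₁} ≥ p̲_{a₂} ≥ … ≥ p̲_{a_d} in (0,1) satisfy p̲_{a_l} ≤ p_{a_l} for every l, and reals p̄_j ∈ (0,1) for j ∈ {1,…,c} \ L satisfy p_j ≤ p̄_j; let p̄_{b₁} ≥ p̄_{b₂} ≥ … ≥ p̄_{b_{c−d}} be these upper bounds sorted in descending order. Let e be an integer with 1 ≤ e ≤ min(d, k), set η = d − e + 1, s = k − e + 1, p̲_{A_u} = ∑_{l=e}^{e+u−1} p̲_{a_l} for u = 1,…,η, and p̄_{B_v} = ∑_{l=s−v+1}^{s} p̄_{b_l} for v = 1,…,s, and assume p̲_{A_u}/k' < 1 and p̄_{B_v}/k' < 1 for all such u, v. If max{ Φ(Φ⁻¹(p̲_{a_e}) − R/σ), max_{u=1,…,η}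 (k'/u) · Φ(Φ⁻¹(p̲_{A_u}/k') − R/σ) } > min{ Φ(Φ⁻¹(p̄_{b_s}) + R/σ), min_{v=1,…,s} (k'/v) · Φ(Φ⁻¹(p̄_{B_v}/k') + R/σ) }, then for every δ ∈ ℝ^d with ‖δ‖₂ ≤ R and every set G ⊆ {1,…,c} with |G| = k that is a top-k set under p*(δ) (i.e. p*(δ)_i ≥ p*(δ)_j for every i ∈ G and j ∉ G), it holds that |L ∩ G| ≥ e. -/

import Mathlib

open MeasureTheory ProbabilityTheory

/-- Isotropic Gaussian measure `N(m, σ²I)` on `ℝ^d`, as a product of 1-D Gaussians. -/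
noncomputable def gaussPi (d : ℕ) (m : Fin d → ℝ) (σ : ℝ) : Measure (Fin d → ℝ) :=
  Measure.pi fun i => gaussianReal (m i) ⟨σ ^ 2, sq_nonneg σ⟩

/-- Standard Gaussian CDF `Φ`. -/
noncomputable def Phi (x : ℝ) : ℝ := (gaussianReal 0 1 (Set.Iic x)).toReal

/-- Inverse of the standard Gaussian CDF, `Φ⁻¹` (genuine inverse on `(0,1)` since `Φ` is a
strictly increasing continuous bijection from `ℝ` onto `(0,1)`). -/
noncomputable def PhiInv : ℝ → ℝ := Function.invFun Phi

/-- Euclidean norm `‖a‖₂` on `ℝ^d`. -/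
noncomputable def enorm2 (d : ℕ) (a : Fin d → ℝ) : ℝ := Real.sqrt (∑ i, a i ^ 2)

theorem gaussianReal_add_eq_withDensity (m t : ℝ) {v : NNReal} (hv : v ≠ 0) :
    gaussianReal (m + t) v = (gaussianReal m v).withDensity
      fun y => ENNReal.ofReal (Real.exp ((t * (y - m) - t ^ 2 / 2) / v)) := by
  have hv' : (v : ℝ) ≠ 0 := by exact_mod_cast hv
  rw [gaussianReal_of_var_ne_zero _ hv, gaussianReal_of_var_ne_zero _ hv,
    ← withDensity_mul _ (measurable_gaussianPDF m v) (by fun_prop)]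
  congr 1
  ext y
  simp only [Pi.mul_apply, gaussianPDF]
  rw [← ENNReal.ofReal_mul (gaussianPDFReal_nonneg _ _ _)]
  congr 1
  simp only [gaussianPDFReal]
  rw [mul_assoc (√(2 * Real.pi * v))⁻¹, ← Real.exp_add]
  congr 2
  field_simp
  ring

theorem integrable_gaussianReal_exp (m t : ℝ) {v : NNReal} :
    Integrable (fun y => Real.exp ((t * (y - m) - t ^ 2 / 2) / v)) (gaussianReal m v) := by
  have h := (integrable_exp_mul_gaussianReal (μ := m) (v := v) (t / v)).const_mul
    (Real.exp ((-(t * m) - t ^ 2 / 2) / v))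
  refine h.congr (Filter.Eventually.of_forall fun y => ?_)
  simp only
  rw [← Real.exp_add]
  congr 1
  ring

theorem gaussPi_eq_pi_toNNReal (d : ℕ) (m : Fin d → ℝ) (σ : ℝ) :
    gaussPi d m σ = Measure.pi fun i => gaussianReal (m i) (σ ^ 2).toNNReal := by
  have h : (⟨σ ^ 2, sq_nonneg σ⟩ : NNReal) = (σ ^ 2).toNNReal :=
    (Real.toNNReal_of_nonneg (sq_nonneg σ)).symm
  unfold gaussPi
  rw [h]

instance isProbabilityMeasure_gaussPi (d : ℕ) (m : Fin d → ℝ) (σ : ℝ) :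
    IsProbabilityMeasure (gaussPi d m σ) := by
  rw [gaussPi_eq_pi_toNNReal]
  infer_instance

theorem gaussPi_density_eq_prod (d : ℕ) (m δ : Fin d → ℝ) (σ : ℝ) (w : Fin d → ℝ) :
    Real.exp ((∑ i, (δ i * (w i - m i) - δ i ^ 2 / 2)) / σ ^ 2) =
      ∏ i, Real.exp ((δ i * (w i - m i) - δ i ^ 2 / 2) / σ ^ 2) := by
  rw [← Real.exp_sum, Finset.sum_div]

theorem integrable_gaussPi_density (d : ℕ) (m δ : Fin d → ℝ) (σ : ℝ) :
    Integrable (fun w => Real.exp ((∑ i, (δ i * (w i - m i) - δ i ^ 2 / 2)) / σ ^ 2))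
      (gaussPi d m σ) := by
  simp_rw [gaussPi_density_eq_prod]
  rw [gaussPi_eq_pi_toNNReal]
  refine Integrable.fintype_prod
    (f := fun i y => Real.exp ((δ i * (y - m i) - δ i ^ 2 / 2) / σ ^ 2)) fun i => ?_
  have h := integrable_gaussianReal_exp (m i) (δ i) (v := (σ ^ 2).toNNReal)
  rwa [Real.coe_toNNReal _ (sq_nonneg σ)] at h

theorem gaussPi_add_eq_withDensity (d : ℕ) (m δ : Fin d → ℝ) {σ : ℝ} (hσ : 0 < σ) :
    gaussPi d (m + δ) σ = (gaussPi d m σ).withDensity fun w =>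
      ENNReal.ofReal (Real.exp ((∑ i, (δ i * (w i - m i) - δ i ^ 2 / 2)) / σ ^ 2)) := by
  have hv : (σ ^ 2).toNNReal ≠ 0 := (Real.toNNReal_pos.mpr (by positivity)).ne'
  have hcoe : ((σ ^ 2).toNNReal : ℝ) = σ ^ 2 := Real.coe_toNNReal _ (sq_nonneg σ)
  rw [gaussPi_eq_pi_toNNReal, gaussPi_eq_pi_toNNReal]
  refine Measure.pi_eq fun s hs => ?_
  rw [withDensity_apply _ (MeasurableSet.univ_pi hs), Measure.restrict_pi_pi]
  simp_rw [gaussPi_density_eq_prod]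
  have hint : ∀ i, Integrable (fun y => Real.exp ((δ i * (y - m i) - δ i ^ 2 / 2) / σ ^ 2))
      ((gaussianReal (m i) (σ ^ 2).toNNReal).restrict (s i)) := fun i => by
    have h := integrable_gaussianReal_exp (m i) (δ i) (v := (σ ^ 2).toNNReal)
    rw [hcoe] at h
    exact h.restrict
  rw [← ofReal_integral_eq_lintegral_ofReal (Integrable.fintype_prod hint)
    (Filter.Eventually.of_forall fun w => by positivity),
    integral_fintype_prod_eq_prod
      (f := fun i y => Real.exp ((δ i * (y - m i) - δ i ^ 2 / 2) / σ ^ 2)),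
    ENNReal.ofReal_prod_of_nonneg fun i _ => integral_nonneg fun y => (Real.exp_pos _).le]
  refine Finset.prod_congr rfl fun i _ => ?_
  rw [ofReal_integral_eq_lintegral_ofReal (hint i)
    (Filter.Eventually.of_forall fun w => (Real.exp_pos _).le), Pi.add_apply,
    gaussianReal_add_eq_withDensity _ _ hv, withDensity_apply _ (hs i), hcoe]

theorem Phi_eq_cdf (x : ℝ) : Phi x = cdf (gaussianReal 0 1) x := by
  rw [cdf_eq_real]; rfl

theorem strictMono_Phi : StrictMono Phi := by
  intro x y hxy
  have hpos : 0 < (gaussianReal 0 1).real (Set.Ioc x y) := by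
    rw [Measure.real, ENNReal.toReal_pos_iff]
    refine ⟨?_, measure_lt_top _ _⟩
    rw [pos_iff_ne_zero]
    intro h
    have := gaussianReal_absolutelyContinuous' 0 (one_ne_zero : (1 : NNReal) ≠ 0) h
    rw [Real.volume_Ioc, ENNReal.ofReal_eq_zero] at this
    linarith
  have := measureReal_union (μ := gaussianReal 0 1) (Set.Iic_disjoint_Ioc le_rfl)
    (measurableSet_Ioc : MeasurableSet (Set.Ioc x y))
  rw [Set.Iic_union_Ioc_eq_Iic hxy.le] at this
  change (gaussianReal 0 1).real _ < (gaussianReal 0 1).real _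
  linarith

theorem continuous_Phi : Continuous Phi := by
  have h : Phi = cdf (gaussianReal 0 1) := funext Phi_eq_cdf
  rw [h, continuous_iff_continuousAt]
  intro x
  have hnull : (cdf (gaussianReal 0 1)).measure {x} = 0 := by
    rw [measure_cdf]
    have := nullSingletonClass_gaussianReal (μ := 0) (one_ne_zero : (1 : NNReal) ≠ 0)
    exact measure_singleton x
  rw [(monotone_cdf _).continuousAt_iff_leftLim_eq_rightLim, StieltjesFunction.rightLim_eq]
  rw [StieltjesFunction.measure_singleton, ENNReal.ofReal_eq_zero] at hnull
  exact le_antisymm ((monotone_cdf _).leftLim_le le_rfl) (by linarith)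

theorem Phi_PhiInv {q : ℝ} (hq : q ∈ Set.Ioo (0 : ℝ) 1) : Phi (PhiInv q) = q := by
  have h : Phi = cdf (gaussianReal 0 1) := funext Phi_eq_cdf
  refine Function.invFun_eq ?_
  refine mem_range_of_exists_le_of_exists_ge continuous_Phi ?_ ?_
  · rw [h]
    exact (((tendsto_cdf_atBot _).eventually_lt_const hq.1).exists).imp fun _ => le_of_lt
  · rw [h]
    exact (((tendsto_cdf_atTop _).eventually_const_lt hq.2).exists).imp fun _ => le_of_lt

theorem gaussianReal_real_Iic (μ t : ℝ) {v : NNReal} (hv : v ≠ 0) :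
    (gaussianReal μ v).real (Set.Iic t) = Phi ((t - μ) / √v) := by
  have hv' : (0 : ℝ) < v := by exact_mod_cast pos_iff_ne_zero.mpr hv
  have hs : 0 < √(v : ℝ) := Real.sqrt_pos.mpr hv'
  have hmap : gaussianReal μ v = ((gaussianReal 0 1).map (√(v : ℝ) * ·)).map (μ + ·) := by
    rw [gaussianReal_map_const_mul, gaussianReal_map_const_add]
    congr 1
    · ring
    · ext
      simp [Real.sq_sqrt hv'.le]
  rw [hmap, map_measureReal_apply (by fun_prop) measurableSet_Iic,
    map_measureReal_apply (by fun_prop) (measurableSet_Iic.preimage (by fun_prop))]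
  unfold Phi
  change _ = (gaussianReal 0 1).real _
  congr 1
  ext y
  simp only [Set.mem_preimage, Set.mem_Iic]
  rw [le_div_iff₀ hs]
  constructor <;> intro h <;> linarith

theorem gaussPi_map_sum_mul (d : ℕ) (m δ : Fin d → ℝ) (σ : ℝ) :
    (gaussPi d m σ).map (fun w => ∑ i, δ i * w i) =
      gaussianReal (∑ i, δ i * m i) (∑ i, δ i ^ 2 * σ ^ 2).toNNReal := by
  have hmp : ∀ i, MeasurePreserving (Function.eval i) (gaussPi d m σ)
      (gaussianReal (m i) (σ ^ 2).toNNReal) := fun i => by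
    rw [gaussPi_eq_pi_toNNReal]
    exact measurePreserving_eval (fun i => gaussianReal (m i) (σ ^ 2).toNNReal) i
  have hlaw : ∀ i, (gaussPi d m σ).map (fun w => δ i * w i) =
      gaussianReal (δ i * m i) (NNReal.mk (δ i ^ 2) (sq_nonneg _) * (σ ^ 2).toNNReal) := by
    intro i
    rw [← gaussianReal_map_const_mul, ← (hmp i).map_eq,
      Measure.map_map (by fun_prop) (by fun_prop)]
    rfl
  have hG : ∀ i, HasGaussianLaw (fun w : Fin d → ℝ => δ i * w i) (gaussPi d m σ) := fun i =>
    ⟨by rw [hlaw i]; infer_instance⟩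
  have hm : ∀ i, AEMeasurable (fun w : Fin d → ℝ => δ i * w i) (gaussPi d m σ) := fun i =>
    (hG i).aemeasurable
  have hI : iIndepFun (fun i (w : Fin d → ℝ) => δ i * w i) (gaussPi d m σ) := by
    rw [gaussPi_eq_pi_toNNReal]
    exact iIndepFun_pi (X := fun i (y : ℝ) => δ i * y) fun i => by fun_prop
  have hsum := (iIndepFun.hasGaussianLaw hG hI).fun_sum
  rw [hsum.map_eq_gaussianReal, integral_finsetSum _ fun i _ => (hG i).integrable]
  congr 1
  · refine Finset.sum_congr rfl fun i _ => ?_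
    have := integral_map (μ := gaussPi d m σ) (φ := fun w => δ i * w i) (f := fun y : ℝ => y)
      (hm i) (by fun_prop)
    rw [← this, hlaw, integral_id_gaussianReal]
  · congr 1
    have := IndepFun.variance_sum (μ := gaussPi d m σ) (s := Finset.univ)
      (X := fun i (w : Fin d → ℝ) => δ i * w i) (fun i _ => (hG i).memLp_two)
      (fun i _ j _ hij => hI.indepFun hij)
    have hfun : (fun w : Fin d → ℝ => ∑ i, δ i * w i) =
        ∑ i, fun (w : Fin d → ℝ) => δ i * w i := by
      ext w; simp
    rw [hfun, this]
    refine Finset.sum_congr rfl fun i _ => ?_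
    have h2 := variance_map (μ := gaussPi d m σ) (X := fun y : ℝ => y)
      (Y := fun w : Fin d → ℝ => δ i * w i) (by fun_prop) (hm i)
    rw [hlaw, variance_fun_id_gaussianReal, NNReal.coe_mul,
      Real.coe_toNNReal _ (sq_nonneg σ)] at h2
    exact h2.symm

/-- Neyman–Pearson: a likelihood-ratio set minimises the mass under the alternative. -/
theorem neymanPearson_withDensity {Ω : Type*} [MeasurableSpace Ω] {P Q : Measure Ω}
    [IsProbabilityMeasure P] {g : Ω → ℝ} (hg : Measurable g) (hg0 : ∀ w, 0 ≤ g w)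
    (hgi : Integrable g P) (hQ : Q = P.withDensity fun w => ENNReal.ofReal (g w))
    {A : Set Ω} (hA : MeasurableSet A) {τ : ℝ} (hτ : 0 ≤ τ) (hin : ∀ w ∈ A, g w ≤ τ)
    (hout : ∀ w ∉ A, τ ≤ g w) {h : Ω → ℝ} (hh : Measurable h) (h0 : ∀ w, 0 ≤ h w)
    (h1 : ∀ w, h w ≤ 1) (hle : P.real A ≤ ∫ w, h w ∂P) : Q.real A ≤ ∫ w, h w ∂Q := by
  have key : ∀ φ : Ω → ℝ, ∫ w, φ w ∂Q = ∫ w, g w * φ w ∂P := by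
    intro φ
    rw [hQ, integral_withDensity_eq_integral_toReal_smul (by fun_prop) (by simp)]
    refine integral_congr_ae (Filter.Eventually.of_forall fun w => ?_)
    simp [ENNReal.toReal_ofReal (hg0 w)]
  have hbd : ∀ φ : Ω → ℝ, Measurable φ → (∀ w, 0 ≤ φ w) → (∀ w, φ w ≤ 1) →
      Integrable φ P ∧ Integrable (fun w => g w * φ w) P := by
    intro φ hφ hφ0 hφ1
    refine ⟨Integrable.of_bound hφ.aestronglyMeasurable 1 (Filter.Eventually.of_forall
      fun w => by rw [Real.norm_of_nonneg (hφ0 w)]; exact hφ1 w), ?_⟩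
    refine hgi.mono (by fun_prop) (Filter.Eventually.of_forall fun w => ?_)
    rw [Real.norm_of_nonneg (mul_nonneg (hg0 w) (hφ0 w)), Real.norm_of_nonneg (hg0 w)]
    exact mul_le_of_le_one_right (hg0 w) (hφ1 w)
  set χ : Ω → ℝ := A.indicator 1 with hχ
  have hχm : Measurable χ := measurable_one.indicator hA
  obtain ⟨hχi, hχgi⟩ := hbd χ hχm (fun w => Set.indicator_nonneg (fun _ _ => zero_le_one) w)
    (fun w => Set.indicator_le_self' (fun _ _ => zero_le_one) w)
  obtain ⟨hhi, hhgi⟩ := hbd h hh h0 h1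
  have hPA : P.real A = ∫ w, χ w ∂P := (integral_indicator_one hA).symm
  have hQA : Q.real A = ∫ w, χ w ∂Q := (integral_indicator_one hA).symm
  rw [hQA, key, key]
  have hmono : ∫ w, τ * (h w - χ w) ∂P ≤ ∫ w, (g w * h w - g w * χ w) ∂P := by
    refine integral_mono ((hhi.sub hχi).const_mul τ) (hhgi.sub hχgi) fun w => ?_
    by_cases hw : w ∈ A
    · have : χ w = 1 := by simp [hχ, hw]
      simp only [this]
      nlinarith [hin w hw, h1 w]
    · have : χ w = 0 := by simp [hχ, hw]
      simp only [this]
      nlinarith [hout w hw, h0 w]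
  rw [integral_const_mul, integral_sub hhi hχi, integral_sub hhgi hχgi] at hmono
  have := mul_nonneg hτ (sub_nonneg.mpr (hPA ▸ hle))
  linarith

theorem Phi_sub_le_integral_gaussPi {d : ℕ} (m δ : Fin d → ℝ) {σ R z : ℝ} (hσ : 0 < σ)
    (hδ : enorm2 d δ ≤ R) {h : (Fin d → ℝ) → ℝ} (hh : Measurable h) (h0 : ∀ w, 0 ≤ h w)
    (h1 : ∀ w, h w ≤ 1) (hle : Phi z ≤ ∫ w, h w ∂gaussPi d m σ) :
    Phi (z - R / σ) ≤ ∫ w, h w ∂gaussPi d (m + δ) σ := by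
  have hS0 : 0 ≤ ∑ i, δ i ^ 2 := Finset.sum_nonneg fun i _ => sq_nonneg _
  rcases hS0.eq_or_lt with hS | hS
  · have hδ0 : δ = 0 := by
      ext i
      have := (Finset.sum_eq_zero_iff_of_nonneg fun i _ => sq_nonneg (δ i)).mp hS.symm i
        (Finset.mem_univ i)
      simpa using this
    have hR : 0 ≤ R := (Real.sqrt_nonneg _).trans hδ
    rw [hδ0, add_zero]
    refine le_trans (strictMono_Phi.monotone ?_) hle
    have : 0 ≤ R / σ := by positivity
    linarith
  set r := enorm2 d δ with hr
  have hrpos : 0 < r := Real.sqrt_pos.mpr hS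
  have hrsq : r ^ 2 = ∑ i, δ i ^ 2 := Real.sq_sqrt hS0
  have hsum : ∑ i, δ i ^ 2 * σ ^ 2 = (r * σ) ^ 2 := by
    rw [← Finset.sum_mul, ← hrsq]; ring
  have hrσ : 0 < r * σ := by positivity
  set T := ∑ i, δ i * m i + r * σ * z with hT
  set A : Set (Fin d → ℝ) := {w | ∑ i, δ i * w i ≤ T} with hA
  have hAm : MeasurableSet A := measurableSet_le (by fun_prop) measurable_const
  have hmass : ∀ m' : Fin d → ℝ,
      (gaussPi d m' σ).real A = Phi ((T - ∑ i, δ i * m' i) / (r * σ)) := by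
    intro m'
    have : A = (fun w => ∑ i, δ i * w i) ⁻¹' Set.Iic T := rfl
    rw [this, ← map_measureReal_apply (by fun_prop) measurableSet_Iic, gaussPi_map_sum_mul,
      gaussianReal_real_Iic, hsum, Real.coe_toNNReal _ (sq_nonneg _), Real.sqrt_sq hrσ.le]
    rw [hsum]
    exact (Real.toNNReal_pos.mpr (by positivity)).ne'
  have hP : (gaussPi d m σ).real A = Phi z := by
    rw [hmass, hT]
    congr 1
    field_simp
    ring
  have hQ : (gaussPi d (m + δ) σ).real A = Phi (z - r / σ) := by
    rw [hmass, hT]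
    congr 1
    have : ∑ i, δ i * (m + δ) i = ∑ i, δ i * m i + r ^ 2 := by
      rw [hrsq, ← Finset.sum_add_distrib]
      exact Finset.sum_congr rfl fun i _ => by simp only [Pi.add_apply]; ring
    rw [this]
    field_simp
    ring
  have hexp : ∀ w : Fin d → ℝ, ∑ i, (δ i * (w i - m i) - δ i ^ 2 / 2) =
      ∑ i, δ i * w i - (∑ i, δ i * m i + r ^ 2 / 2) := by
    intro w
    rw [hrsq, Finset.sum_div, ← Finset.sum_add_distrib, ← Finset.sum_sub_distrib]
    exact Finset.sum_congr rfl fun i _ => by ring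
  have hNP := neymanPearson_withDensity (by fun_prop) (fun w => (Real.exp_pos _).le)
    (integrable_gaussPi_density d m δ σ) (gaussPi_add_eq_withDensity d m δ hσ) hAm
    (τ := Real.exp ((T - (∑ i, δ i * m i + r ^ 2 / 2)) / σ ^ 2)) (Real.exp_pos _).le
    (fun w hw => by
      have hw' : ∑ i, δ i * w i ≤ T := hw
      rw [hexp]
      gcongr)
    (fun w hw => by
      have hw' : T < ∑ i, δ i * w i := not_le.mp hw
      rw [hexp]
      gcongr) hh h0 h1 (hP.trans_le hle)
  rw [hQ] at hNP
  refine le_trans (strictMono_Phi.monotone ?_) hNP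
  gcongr

theorem integral_gaussPi_le_Phi_add {d : ℕ} (m δ : Fin d → ℝ) {σ R z : ℝ} (hσ : 0 < σ)
    (hδ : enorm2 d δ ≤ R) {h : (Fin d → ℝ) → ℝ} (hh : Measurable h) (h0 : ∀ w, 0 ≤ h w)
    (h1 : ∀ w, h w ≤ 1) (hle : ∫ w, h w ∂gaussPi d m σ ≤ Phi z) :
    ∫ w, h w ∂gaussPi d (m + δ) σ ≤ Phi (z + R / σ) := by
  by_contra! hlt
  have hev := (continuous_Phi.tendsto (z + R / σ)).eventually_lt_const hlt
  obtain ⟨z', hz', hzz⟩ :=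
    ((hev.filter_mono nhdsWithin_le_nhds).and
      (self_mem_nhdsWithin (s := Set.Ioi (z + R / σ)))).exists
  have hneg : enorm2 d (-δ) ≤ R := by simpa [enorm2] using hδ
  have := Phi_sub_le_integral_gaussPi (m + δ) (-δ) hσ hneg hh h0 h1 hz'.le
  rw [add_neg_cancel_right] at this
  have h3 : z < z' - R / σ := by
    have : z + R / σ < z' := hzz
    linarith
  exact absurd (strictMono_Phi h3) (not_lt.mpr (this.trans hle))

theorem exists_subset_card_sum_Icc_le {q : ℕ → ℝ} {n e : ℕ}
    (hq : ∀ l₁ l₂, 1 ≤ l₁ → l₁ ≤ l₂ → l₂ ≤ n → q l₂ ≤ q l₁) {J : Finset ℕ}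
    (hJ : J ⊆ Finset.Icc 1 n) (he : 1 ≤ e) (hcard : n + 1 ≤ e + J.card) (u : ℕ)
    (hu : e + u ≤ n + 1) :
    ∃ J' ⊆ J, J'.card = u ∧ ∑ l ∈ Finset.Icc e (e + u - 1), q l ≤ ∑ l ∈ J', q l := by
  induction u with
  | zero => exact ⟨∅, by simp, rfl, by simp [Finset.Icc_eq_empty_of_lt (show e - 1 < e by omega)]⟩
  | succ u ih =>
    obtain ⟨J', hJ', hc, hsum⟩ := ih (by omega)
    have hJsub : J ⊆ (J.filter (· ≤ e + u)) ∪ Finset.Icc (e + u + 1) n := by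
      intro l hl
      have := Finset.mem_Icc.mp (hJ hl)
      simp only [Finset.mem_union, Finset.mem_filter, Finset.mem_Icc, hl, true_and]
      omega
    have h2 := (Finset.card_le_card hJsub).trans (Finset.card_union_le _ _)
    rw [Nat.card_Icc] at h2
    obtain ⟨l, hl, hlJ⟩ := Finset.exists_mem_notMem_of_card_lt_card
      (show J'.card < (J.filter (· ≤ e + u)).card by omega)
    rw [Finset.mem_filter] at hl
    have hl1 := (Finset.mem_Icc.mp (hJ hl.1)).1
    refine ⟨insert l J', Finset.insert_subset hl.1 hJ', by simp [hlJ, hc], ?_⟩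
    rw [Finset.sum_insert hlJ, show e + (u + 1) - 1 = (e + u - 1) + 1 by omega,
      Finset.sum_Icc_succ_top (by omega), show e + u - 1 + 1 = e + u by omega]
    linarith [hq l (e + u) hl1 hl.2 (by omega)]

theorem exists_subset_card_sum_le_Icc {q : ℕ → ℝ} {n s : ℕ}
    (hq : ∀ l₁ l₂, 1 ≤ l₁ → l₁ ≤ l₂ → l₂ ≤ n → q l₂ ≤ q l₁) {J : Finset ℕ}
    (hJ : J ⊆ Finset.Icc 1 n) (hcard : s ≤ J.card) (v : ℕ) (hv : v ≤ s) :
    ∃ J' ⊆ J, J'.card = v ∧ ∑ l ∈ J', q l ≤ ∑ l ∈ Finset.Icc (s - v + 1) s, q l := by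
  induction v with
  | zero => exact ⟨∅, by simp, rfl, by simp⟩
  | succ v ih =>
    obtain ⟨J', hJ', hc, hsum⟩ := ih (by omega)
    have hJsub : J ⊆ (J.filter (s - v ≤ ·)) ∪ Finset.Icc 1 (s - v - 1) := by
      intro l hl
      have := Finset.mem_Icc.mp (hJ hl)
      simp only [Finset.mem_union, Finset.mem_filter, Finset.mem_Icc, hl, true_and]
      omega
    have h2 := (Finset.card_le_card hJsub).trans (Finset.card_union_le _ _)
    rw [Nat.card_Icc] at h2
    obtain ⟨l, hl, hlJ⟩ := Finset.exists_mem_notMem_of_card_lt_card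
      (show J'.card < (J.filter (s - v ≤ ·)).card by omega)
    rw [Finset.mem_filter] at hl
    have hl1 := (Finset.mem_Icc.mp (hJ hl.1)).2
    refine ⟨insert l J', Finset.insert_subset hl.1 hJ', by simp [hlJ, hc], ?_⟩
    rw [Finset.sum_insert hlJ, show s - (v + 1) + 1 = s - v by omega,
      ← Finset.add_sum_Ioc_eq_sum_Icc (show s - v ≤ s by omega),
      ← Finset.Icc_add_one_left_eq_Ioc]
    linarith [hq (s - v) l (by omega) hl.2 hl1]

theorem integral_normalized_count {Ω ι : Type*} [MeasurableSpace Ω] [DecidableEq ι]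
    (P : Measure Ω) [IsProbabilityMeasure P] (f : Ω → Finset ι)
    (hfm : ∀ i, MeasurableSet {w | i ∈ f w}) (S : Finset ι) (N : ℝ) :
    ∫ w, (∑ i ∈ S, {w | i ∈ f w}.indicator (1 : Ω → ℝ) w) / N ∂P =
      (∑ i ∈ S, P.real {w | i ∈ f w}) / N := by
  rw [integral_div, integral_finsetSum _ fun i _ =>
    (show Integrable (1 : Ω → ℝ) P from integrable_const 1).indicator (hfm i)]
  simp_rw [integral_indicator_one (hfm _)]

theorem sum_indicator_mem_eq_card {Ω ι : Type*} [DecidableEq ι] (f : Ω → Finset ι)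
    (S : Finset ι) (w : Ω) :
    ∑ i ∈ S, {w | i ∈ f w}.indicator (1 : Ω → ℝ) w = ((S ∩ f w).card : ℝ) := by
  simp [Set.indicator_apply]

/-- Certified bounds for the total probability of a set of labels, at most `N` of which are
output simultaneously. -/
theorem gaussPi_label_sum_bounds {d : ℕ} {ι : Type*} [DecidableEq ι] (m δ : Fin d → ℝ) {σ R : ℝ}
    (hσ : 0 < σ) (hδ : enorm2 d δ ≤ R) (f : (Fin d → ℝ) → Finset ι)
    (hfm : ∀ i, MeasurableSet {w | i ∈ f w}) (S : Finset ι) {N : ℕ} (hN : 1 ≤ N)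
    (hS : ∀ w, (S ∩ f w).card ≤ N) {q : ℝ} (hq : q / N ∈ Set.Ioo (0 : ℝ) 1) :
    (q ≤ ∑ i ∈ S, (gaussPi d m σ).real {w | i ∈ f w} →
      N * Phi (PhiInv (q / N) - R / σ) ≤ ∑ i ∈ S, (gaussPi d (m + δ) σ).real {w | i ∈ f w}) ∧
    (∑ i ∈ S, (gaussPi d m σ).real {w | i ∈ f w} ≤ q →
      ∑ i ∈ S, (gaussPi d (m + δ) σ).real {w | i ∈ f w} ≤ N * Phi (PhiInv (q / N) + R / σ)) := by
  have hN' : (0 : ℝ) < N := by exact_mod_cast hN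
  set h : (Fin d → ℝ) → ℝ := fun w =>
    (∑ i ∈ S, {w | i ∈ f w}.indicator (1 : (Fin d → ℝ) → ℝ) w) / N with hh
  have hm : Measurable h := (Finset.measurable_fun_sum S fun i _ =>
    measurable_one.indicator (hfm i)).div_const _
  have h0 : ∀ w, 0 ≤ h w := fun w => by
    simp only [hh, sum_indicator_mem_eq_card]; positivity
  have h1 : ∀ w, h w ≤ 1 := fun w => by
    simp only [hh, sum_indicator_mem_eq_card]
    rw [div_le_one hN']
    exact_mod_cast hS w
  constructor
  · intro hle
    have := Phi_sub_le_integral_gaussPi m δ hσ hδ hm h0 h1 (z := PhiInv (q / N)) (by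
      rw [Phi_PhiInv hq, integral_normalized_count _ f hfm]
      gcongr)
    rwa [integral_normalized_count _ f hfm, le_div_iff₀' hN'] at this
  · intro hle
    have := integral_gaussPi_le_Phi_add m δ hσ hδ hm h0 h1 (z := PhiInv (q / N)) (by
      rw [Phi_PhiInv hq, integral_normalized_count _ f hfm]
      gcongr)
    rwa [integral_normalized_count _ f hfm, div_le_iff₀' hN'] at this

/-- **Certified intersection size (Theorem 1 of MultiGuard).**
`f` is a measurable base multi-label classifier on `ℝ^dd` outputting exactly `k'` labels
from `{1,…,c}`; `pstar δ i = Pr(i ∈ f_{k'}(x+δ+ε))` with `ε ~ N(0,σ²I)` are the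
(adversarial) label probabilities; `L = {a₁,…,a_dl}` has lower bounds
`p̲_{a₁} ≥ … ≥ p̲_{a_dl}` in `(0,1)` (indexed `1,…,dl` via `plow ∘ —`, i.e. `plow l ≤ p_{a_l}`),
and the labels outside `L` have upper bounds `pupp j ∈ (0,1)` with `p_j ≤ pupp j`, sorted
descendingly as `pupp (b 1) ≥ … ≥ pupp (b (c−dl))`. With `1 ≤ e ≤ min(dl,k)`, `η = dl−e+1`,
`s = k−e+1`, `p̲_{A_u} = ∑_{l=e}^{e+u−1} p̲_{a_l}`, `p̄_{B_v} = ∑_{l=s−v+1}^{s} p̄_{b_l}`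
(all `< k'`): if
`max{Φ(Φ⁻¹(p̲_{a_e}) − R/σ), max_{u=1..η} (k'/u)Φ(Φ⁻¹(p̲_{A_u}/k') − R/σ)} >
 min{Φ(Φ⁻¹(p̄_{b_s}) + R/σ), min_{v=1..s} (k'/v)Φ(Φ⁻¹(p̄_{B_v}/k') + R/σ)}`,
then for every `δ` with `‖δ‖₂ ≤ R` and every top-`k` set `G` under `pstar δ`,
`|L ∩ G| ≥ e`. -/
theorem stmt16 (dd c k' : ℕ) (hk'1 : 1 ≤ k') (hc : 1 ≤ c)
    (f : (Fin dd → ℝ) → Finset (Fin c)) (hfcard : ∀ w, (f w).card = k')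
    (hfm : ∀ i : Fin c, MeasurableSet {w : Fin dd → ℝ | i ∈ f w})
    (x : Fin dd → ℝ) (σ R : ℝ) (hσ : 0 < σ) (hR : 0 < R)
    (k : ℕ) (hk1 : 1 ≤ k) (hkc : k ≤ c)
    (pstar : (Fin dd → ℝ) → Fin c → ℝ)
    (hpstar : ∀ δ i, pstar δ i = ((gaussPi dd (x + δ) σ) {w | i ∈ f w}).toReal)
    (dl : ℕ) (a : ℕ → Fin c)
    (ha_inj : ∀ l₁ l₂, 1 ≤ l₁ → l₁ ≤ dl → 1 ≤ l₂ → l₂ ≤ dl → a l₁ = a l₂ → l₁ = l₂)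
    (L : Finset (Fin c)) (hL : L = (Finset.Icc 1 dl).image a)
    (plow : ℕ → ℝ)
    (hplow_sorted : ∀ l₁ l₂, 1 ≤ l₁ → l₁ ≤ l₂ → l₂ ≤ dl → plow l₂ ≤ plow l₁)
    (hplow_mem : ∀ l, 1 ≤ l → l ≤ dl → plow l ∈ Set.Ioo (0 : ℝ) 1)
    (hplow_le : ∀ l, 1 ≤ l → l ≤ dl → plow l ≤ pstar 0 (a l))
    (pupp : Fin c → ℝ)
    (hpupp_mem : ∀ j, j ∉ L → pupp j ∈ Set.Ioo (0 : ℝ) 1)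
    (hpupp_ge : ∀ j, j ∉ L → pstar 0 j ≤ pupp j)
    (b : ℕ → Fin c)
    (hb_inj : ∀ l₁ l₂, 1 ≤ l₁ → l₁ ≤ c - dl → 1 ≤ l₂ → l₂ ≤ c - dl → b l₁ = b l₂ → l₁ = l₂)
    (hb_mem : ∀ l, 1 ≤ l → l ≤ c - dl → b l ∉ L)
    (hb_sorted : ∀ l₁ l₂, 1 ≤ l₁ → l₁ ≤ l₂ → l₂ ≤ c - dl → pupp (b l₂) ≤ pupp (b l₁))
    (e : ℕ) (he1 : 1 ≤ e) (hemin : e ≤ min dl k)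
    (η s : ℕ) (hη : η = dl - e + 1) (hs : s = k - e + 1)
    (pA pB : ℕ → ℝ)
    (hpA : ∀ u, pA u = ∑ l ∈ Finset.Icc e (e + u - 1), plow l)
    (hpB : ∀ v, pB v = ∑ l ∈ Finset.Icc (s - v + 1) s, pupp (b l))
    (hpAlt : ∀ u, 1 ≤ u → u ≤ η → pA u / (k' : ℝ) < 1)
    (hpBlt : ∀ v, 1 ≤ v → v ≤ s → pB v / (k' : ℝ) < 1)
    (hcond :
      min (Phi (PhiInv (pupp (b s)) + R / σ))
          ((Finset.Icc 1 s).inf' ⟨1, Finset.mem_Icc.mpr ⟨le_refl 1, by omega⟩⟩ fun v =>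
            (k' : ℝ) / (v : ℝ) * Phi (PhiInv (pB v / (k' : ℝ)) + R / σ)) <
        max (Phi (PhiInv (plow e) - R / σ))
          ((Finset.Icc 1 η).sup' ⟨1, Finset.mem_Icc.mpr ⟨le_refl 1, by omega⟩⟩ fun u =>
            (k' : ℝ) / (u : ℝ) * Phi (PhiInv (pA u / (k' : ℝ)) - R / σ))) :
    ∀ δ : Fin dd → ℝ, enorm2 dd δ ≤ R →
      ∀ G : Finset (Fin c), G.card = k →
        (∀ i ∈ G, ∀ j ∉ G, pstar δ j ≤ pstar δ i) →
        e ≤ (L ∩ G).card := by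
  classical
  intro δ hδ G hG htop
  by_contra! hlt
  have hedl : e ≤ dl := hemin.trans (min_le_left _ _)
  have hek : e ≤ k := hemin.trans (min_le_right _ _)
  have hk'0 : (0 : ℝ) < k' := by exact_mod_cast hk'1
  have hp0 : ∀ i, pstar 0 i = (gaussPi dd x σ).real {w | i ∈ f w} := by
    intro i; rw [hpstar, add_zero]; rfl
  have hpδ : ∀ i, pstar δ i = (gaussPi dd (x + δ) σ).real {w | i ∈ f w} := fun i => hpstar δ i
  have ha : Set.InjOn a (Finset.Icc 1 dl) := by
    intro l₁ h₁ l₂ h₂ h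
    rw [Finset.mem_coe, Finset.mem_Icc] at h₁ h₂
    exact ha_inj _ _ h₁.1 h₁.2 h₂.1 h₂.2 h
  have hb : Set.InjOn b (Finset.Icc 1 (c - dl)) := by
    intro l₁ h₁ l₂ h₂ h
    rw [Finset.mem_coe, Finset.mem_Icc] at h₁ h₂
    exact hb_inj _ _ h₁.1 h₁.2 h₂.1 h₂.2 h
  have hLcard : L.card = dl := by
    rw [hL, Finset.card_image_of_injOn ha, Nat.card_Icc]; omega
  have hbL : (Finset.Icc 1 (c - dl)).image b = Lᶜ := by
    refine Finset.eq_of_subset_of_card_le ?_ ?_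
    · intro j hj
      obtain ⟨l, hl, rfl⟩ := Finset.mem_image.mp hj
      rw [Finset.mem_Icc] at hl
      exact Finset.mem_compl.mpr (hb_mem l hl.1 hl.2)
    · rw [Finset.card_image_of_injOn hb, Nat.card_Icc, Finset.card_compl, Fintype.card_fin, hLcard]
      omega
  have hLG : (L \ G).card + (L ∩ G).card = L.card := Finset.card_sdiff_add_card_inter L G
  have hGL : (G \ L).card + (L ∩ G).card = G.card := by
    rw [Finset.inter_comm]; exact Finset.card_sdiff_add_card_inter G L
  have hcap1 : ∀ (i : Fin c) w, (({i} : Finset (Fin c)) ∩ f w).card ≤ 1 := fun i w =>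
    (Finset.card_le_card Finset.inter_subset_left).trans (by simp)
  have hcapk : ∀ (S : Finset (Fin c)) w, (S ∩ f w).card ≤ k' := fun S w =>
    (Finset.card_le_card Finset.inter_subset_right).trans (hfcard w).le
  set J := (Finset.Icc 1 dl).filter fun l => a l ∉ G with hJ
  have hJimg : J.image a = L \ G := by
    ext j
    simp only [hJ, hL, Finset.mem_image, Finset.mem_filter, Finset.mem_sdiff]
    constructor
    · rintro ⟨l, ⟨h1, h2⟩, rfl⟩
      exact ⟨⟨l, h1, rfl⟩, h2⟩
    · rintro ⟨⟨l, h1, rfl⟩, h2⟩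
      exact ⟨l, ⟨h1, h2⟩, rfl⟩
  have hJcard : J.card = (L \ G).card := by
    rw [← hJimg, Finset.card_image_of_injOn (ha.mono (Finset.coe_subset.mpr (Finset.filter_subset _ _)))]
  set K := (Finset.Icc 1 (c - dl)).filter fun l => b l ∈ G with hK
  have hKimg : K.image b = G \ L := by
    ext j
    rw [Finset.mem_sdiff, ← Finset.mem_compl, ← hbL]
    simp only [hK, Finset.mem_image, Finset.mem_filter]
    constructor
    · rintro ⟨l, ⟨h1, h2⟩, rfl⟩
      exact ⟨h2, ⟨l, h1, rfl⟩⟩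
    · rintro ⟨h2, ⟨l, h1, rfl⟩⟩
      exact ⟨l, ⟨h1, h2⟩, rfl⟩
  have hKcard : K.card = (G \ L).card := by
    rw [← hKimg, Finset.card_image_of_injOn (hb.mono (Finset.coe_subset.mpr (Finset.filter_subset _ _)))]
  have hKle : K.card ≤ c - dl := by
    have := Finset.card_filter_le (Finset.Icc 1 (c - dl)) fun l => b l ∈ G
    rwa [Nat.card_Icc, Nat.add_sub_cancel] at this
  have hlower : ∃ i, i ∉ G ∧ max (Phi (PhiInv (plow e) - R / σ))
      ((Finset.Icc 1 η).sup' ⟨1, Finset.mem_Icc.mpr ⟨le_refl 1, by omega⟩⟩ fun u =>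
        (k' : ℝ) / (u : ℝ) * Phi (PhiInv (pA u / (k' : ℝ)) - R / σ)) ≤ pstar δ i := by
    have hsub := fun u hu => exists_subset_card_sum_Icc_le hplow_sorted
      (J := J) (Finset.filter_subset _ _) he1 (by omega) u hu
    have hle0 : ∀ J' ⊆ J, ∑ l ∈ J', plow l ≤ ∑ i ∈ J'.image a,
        (gaussPi dd x σ).real {w | i ∈ f w} := by
      intro J' hJ'
      rw [Finset.sum_image (ha.mono (by
        intro l hl; exact (Finset.mem_filter.mp (hJ' hl)).1))]
      refine Finset.sum_le_sum fun l hl => ?_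
      have := Finset.mem_Icc.mp (Finset.mem_filter.mp (hJ' hl)).1
      rw [← hp0]
      exact hplow_le l this.1 this.2
    rcases max_choice (Phi (PhiInv (plow e) - R / σ))
      ((Finset.Icc 1 η).sup' ⟨1, Finset.mem_Icc.mpr ⟨le_refl 1, by omega⟩⟩ fun u =>
        (k' : ℝ) / (u : ℝ) * Phi (PhiInv (pA u / (k' : ℝ)) - R / σ)) with h | h
    · obtain ⟨J', hJ', hc1, hsum⟩ := hsub 1 (by omega)
      obtain ⟨l, rfl⟩ := Finset.card_eq_one.mp hc1
      have h2 := hsum.trans (hle0 _ hJ')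
      simp only [Nat.add_sub_cancel, Finset.Icc_self, Finset.sum_singleton,
        Finset.image_singleton] at h2
      have h3 := (gaussPi_label_sum_bounds x δ hσ hδ f hfm {a l} le_rfl (hcap1 _)
        (q := plow e) (by simpa using hplow_mem e he1 hedl)).1 (by simpa using h2)
      refine ⟨a l, (Finset.mem_filter.mp (hJ' (Finset.mem_singleton_self l))).2, ?_⟩
      rw [h, hpδ]
      simpa using h3
    · obtain ⟨u, hu, hmax⟩ := Finset.exists_mem_eq_sup' (s := Finset.Icc 1 η)
        ⟨1, Finset.mem_Icc.mpr ⟨le_refl 1, by omega⟩⟩ fun u : ℕ =>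
        (k' : ℝ) / (u : ℝ) * Phi (PhiInv (pA u / (k' : ℝ)) - R / σ)
      rw [h, hmax]
      rw [Finset.mem_Icc] at hu
      have hu0 : (0 : ℝ) < u := by exact_mod_cast hu.1
      obtain ⟨J', hJ', hcu, hsum⟩ := hsub u (by omega)
      have hpos : 0 < pA u := by
        rw [hpA]
        refine Finset.sum_pos (fun l hl => ?_) ⟨e, Finset.mem_Icc.mpr ⟨le_rfl, by omega⟩⟩
        rw [Finset.mem_Icc] at hl
        exact (hplow_mem l (by omega) (by omega)).1
      have h3 := (gaussPi_label_sum_bounds x δ hσ hδ f hfm (J'.image a) hk'1 (hcapk _)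
        (q := pA u) ⟨by positivity, hpAlt u hu.1 hu.2⟩).1
        ((hpA u).trans_le (hsum.trans (hle0 J' hJ')))
      rw [Finset.sum_image (ha.mono (by
        intro l hl; exact (Finset.mem_filter.mp (hJ' hl)).1))] at h3
      obtain ⟨l, hl, hle⟩ := Finset.exists_le_of_sum_le
        (s := J') (f := fun _ => (k' : ℝ) / u * Phi (PhiInv (pA u / k') - R / σ))
        (g := fun l => (gaussPi dd (x + δ) σ).real {w | a l ∈ f w})
        (Finset.card_pos.mp (by omega)) (by
          rw [Finset.sum_const, hcu, nsmul_eq_mul]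
          refine le_trans (le_of_eq ?_) h3
          field_simp)
      exact ⟨a l, (Finset.mem_filter.mp (hJ' hl)).2, hle.trans_eq (hpδ _).symm⟩
  have hupper : ∃ j, j ∈ G ∧ pstar δ j ≤ min (Phi (PhiInv (pupp (b s)) + R / σ))
      ((Finset.Icc 1 s).inf' ⟨1, Finset.mem_Icc.mpr ⟨le_refl 1, by omega⟩⟩ fun v =>
        (k' : ℝ) / (v : ℝ) * Phi (PhiInv (pB v / (k' : ℝ)) + R / σ)) := by
    have hsub := fun v hv => exists_subset_card_sum_le_Icc (q := fun l => pupp (b l)) hb_sorted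
      (J := K) (Finset.filter_subset _ _) (s := s) (by omega) v hv
    have hle0 : ∀ K' ⊆ K, ∑ i ∈ K'.image b,
        (gaussPi dd x σ).real {w | i ∈ f w} ≤ ∑ l ∈ K', pupp (b l) := by
      intro K' hK'
      rw [Finset.sum_image (hb.mono (by
        intro l hl; exact (Finset.mem_filter.mp (hK' hl)).1))]
      refine Finset.sum_le_sum fun l hl => ?_
      have := Finset.mem_Icc.mp (Finset.mem_filter.mp (hK' hl)).1
      rw [← hp0]
      exact hpupp_ge _ (hb_mem l this.1 this.2)
    rcases min_choice (Phi (PhiInv (pupp (b s)) + R / σ))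
      ((Finset.Icc 1 s).inf' ⟨1, Finset.mem_Icc.mpr ⟨le_refl 1, by omega⟩⟩ fun v =>
        (k' : ℝ) / (v : ℝ) * Phi (PhiInv (pB v / (k' : ℝ)) + R / σ)) with h | h
    · obtain ⟨K', hK', hc1, hsum⟩ := hsub 1 (by omega)
      obtain ⟨l, rfl⟩ := Finset.card_eq_one.mp hc1
      have h2 := (hle0 _ hK').trans hsum
      rw [show s - 1 + 1 = s by omega] at h2
      simp only [Finset.Icc_self, Finset.sum_singleton, Finset.image_singleton] at h2
      have h3 := (gaussPi_label_sum_bounds x δ hσ hδ f hfm {b l} le_rfl (hcap1 _)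
        (q := pupp (b s)) (by simpa using hpupp_mem _ (hb_mem s (by omega) (by omega)))).2
        (by simpa using h2)
      refine ⟨b l, (Finset.mem_filter.mp (hK' (Finset.mem_singleton_self l))).2, ?_⟩
      rw [h, hpδ]
      simpa using h3
    · obtain ⟨v, hv, hmin⟩ := Finset.exists_mem_eq_inf' (s := Finset.Icc 1 s)
        ⟨1, Finset.mem_Icc.mpr ⟨le_refl 1, by omega⟩⟩ fun v : ℕ =>
        (k' : ℝ) / (v : ℝ) * Phi (PhiInv (pB v / (k' : ℝ)) + R / σ)
      rw [h, hmin]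
      rw [Finset.mem_Icc] at hv
      have hv0 : (0 : ℝ) < v := by exact_mod_cast hv.1
      obtain ⟨K', hK', hcv, hsum⟩ := hsub v hv.2
      have hpos : 0 < pB v := by
        rw [hpB]
        refine Finset.sum_pos (fun l hl => ?_) ⟨s, Finset.mem_Icc.mpr ⟨by omega, le_rfl⟩⟩
        rw [Finset.mem_Icc] at hl
        exact (hpupp_mem _ (hb_mem l (by omega) (by omega))).1
      have h3 := (gaussPi_label_sum_bounds x δ hσ hδ f hfm (K'.image b) hk'1 (hcapk _)
        (q := pB v) ⟨by positivity, hpBlt v hv.1 hv.2⟩).2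
        (((hle0 K' hK').trans hsum).trans_eq (hpB v).symm)
      rw [Finset.sum_image (hb.mono (by
        intro l hl; exact (Finset.mem_filter.mp (hK' hl)).1))] at h3
      obtain ⟨l, hl, hle⟩ := Finset.exists_le_of_sum_le
        (s := K') (g := fun _ => (k' : ℝ) / v * Phi (PhiInv (pB v / k') + R / σ))
        (f := fun l => (gaussPi dd (x + δ) σ).real {w | b l ∈ f w})
        (Finset.card_pos.mp (by omega)) (by
          rw [Finset.sum_const, hcv, nsmul_eq_mul]
          refine le_trans h3 (le_of_eq ?_)
          field_simp)
      exact ⟨b l, (Finset.mem_filter.mp (hK' hl)).2, (hpδ _).trans_le hle⟩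
  obtain ⟨i, hiG, hi⟩ := hlower
  obtain ⟨j, hjG, hj⟩ := hupper
  have := htop j hjG i hiG
  linarith
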